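/- arXiv:1906.03766 — 2 statements merged into one kernel-verified Lean document; each statement's English description precedes it below -/
import Mathlib

section
/- Let d ≥ 1, let f : ℝ^d → ℝ be continuously differentiable with bounded derivative, let δ > 0, and let w ∈ ℝ^d. Define the smoothed function f̂(w) = E_{v ~ Unif(B^d)}[f(w + δ v)], where Unif(B^d) is the uniform (normalized Lebesgue) probability measure on the closed unit ball. Then f̂ is differentiable at w and E_{u ~ Unif(S^{d-1})}[f(w + δ u) · u] = (δ/d) ∇f̂(w), where Unif(S^{d-1}) is the uniform (normalized surface) probability measure on the unit sphere and the expectation on the left is a vector-valued integral. -/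
open MeasureTheory Metric

/-- The uniform (normalized Lebesgue) probability measure on the closed unit ball
of `ℝ^d`. -/
noncomputable def ballUniform (d : ℕ) : Measure (EuclideanSpace ℝ (Fin d)) :=
  (volume (closedBall (0 : EuclideanSpace ℝ (Fin d)) 1))⁻¹ •
    volume.restrict (closedBall (0 : EuclideanSpace ℝ (Fin d)) 1)

/-- The uniform (normalized surface) probability measure on the unit sphere of `ℝ^d`. -/
noncomputable def sphereUniform (d : ℕ) :
    Measure (sphere (0 : EuclideanSpace ℝ (Fin d)) 1) :=
  ((volume (α := EuclideanSpace ℝ (Fin d))).toSphere Set.univ)⁻¹ •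
    (volume (α := EuclideanSpace ℝ (Fin d))).toSphere

/-- The smoothed function `f̂(w) = 𝔼_{v ~ Unif(B^d)}[f (w + δ v)]`. -/
noncomputable def smoothed (d : ℕ) (δ : ℝ) (f : EuclideanSpace ℝ (Fin d) → ℝ)
    (w : EuclideanSpace ℝ (Fin d)) : ℝ :=
  ∫ v, f (w + δ • v) ∂(ballUniform d)

section Helpers

variable {E : Type*} [NormedAddCommGroup E] [InnerProductSpace ℝ E] [FiniteDimensional ℝ E]
  [MeasurableSpace E] [BorelSpace E] [Nontrivial E]

theorem polar_aux (μ : Measure E) [μ.IsAddHaarMeasure] (h : E → ℝ)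
    (F : ℝ → sphere (0 : E) 1 → ℝ)
    (hF : Continuous (fun p : ℝ × sphere (0 : E) 1 => F p.1 p.2))
    (hh : ∀ (r : ℝ) (u : sphere (0 : E) 1), 0 < r → h (r • (u : E)) = F r u)
    (R : ℝ) (hR : 0 < R) :
    ∫ x in closedBall (0 : E) R, h x ∂μ =
      ∫ r in (0 : ℝ)..R, r ^ (Module.finrank ℝ E - 1) * ∫ u, F r u ∂μ.toSphere := by
  have : CompactSpace (sphere (0 : E) 1) := isCompact_iff_compactSpace.1 (isCompact_sphere _ _)
  set n := Module.finrank ℝ E - 1 with hn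
  set T : Set (sphere (0 : E) 1 × Set.Ioi (0 : ℝ)) := {p | (p.2 : ℝ) ≤ R} with hT
  have hTm : MeasurableSet T := by
    apply measurableSet_le <;> fun_prop
  have hint : Integrable (T.indicator (fun p => F p.2 p.1))
      (μ.toSphere.prod (Measure.volumeIoiPow n)) := by
    rw [integrable_indicator_iff hTm]
    obtain ⟨M, hM⟩ := ((isCompact_Icc (a := (0:ℝ)) (b := R)).prod
      (isCompact_univ (X := sphere (0 : E) 1))).exists_bound_of_continuousOn hF.continuousOn
    refine Measure.integrableOn_of_bounded (M := M) ?_ ?_ ?_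
    · refine ne_top_of_le_ne_top (b := (μ.toSphere.prod (Measure.volumeIoiPow n))
        (Set.univ ×ˢ Set.Iio ⟨R + 1, by simp; linarith⟩)) ?_ (measure_mono ?_)
      · rw [Measure.prod_prod, Measure.volumeIoiPow_apply_Iio]
        exact ENNReal.mul_ne_top (measure_ne_top _ _) ENNReal.ofReal_ne_top
      · rintro ⟨u, r⟩ hr
        simp only [hT, Set.mem_setOf_eq] at hr
        simp only [Set.mem_prod, Set.mem_univ, true_and, Set.mem_Iio, ← Subtype.coe_lt_coe]
        linarith
    · apply Continuous.aestronglyMeasurable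
      exact hF.comp (by fun_prop : Continuous
        (fun p : sphere (0 : E) 1 × Set.Ioi (0 : ℝ) => ((p.2 : ℝ), p.1)))
    · refine (ae_restrict_iff' hTm).2 (Filter.Eventually.of_forall ?_)
      rintro ⟨u, r⟩ hr
      exact hM (r, u) ⟨⟨le_of_lt r.2, hr⟩, trivial⟩
  calc
    ∫ x in closedBall (0 : E) R, h x ∂μ = ∫ x, (closedBall (0 : E) R).indicator h x ∂μ :=
      (integral_indicator measurableSet_closedBall).symm
    _ = ∫ x : ({(0)}ᶜ : Set E), (closedBall (0 : E) R).indicator h x ∂(μ.comap (↑)) := by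
      rw [integral_subtype_comap (measurableSet_singleton _).compl
        fun x ↦ (closedBall (0 : E) R).indicator h x,
        restrict_compl_singleton]
    _ = ∫ p, T.indicator (fun p => F p.2 p.1) p
          ∂μ.toSphere.prod (Measure.volumeIoiPow n) := by
      rw [← μ.measurePreserving_homeomorphUnitSphereProd.integral_comp
        (Homeomorph.measurableEmbedding _)]
      congr 1
      ext x
      have hx : (x : E) ≠ 0 := x.2
      have hx' : 0 < ‖(x : E)‖ := norm_pos_iff.2 hx
      have h1 := hh ‖(x : E)‖ (homeomorphUnitSphereProd E x).1 hx'
      have h2 : ‖(x : E)‖ • ((homeomorphUnitSphereProd E x).1 : E) = x := by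
        simp [smul_smul, hx'.ne']
      rw [h2] at h1
      by_cases hxR : ‖(x : E)‖ ≤ R
      · rw [Set.indicator_of_mem (by simpa using hxR), Set.indicator_of_mem (by simpa [hT] using hxR), h1]
        simp
      · rw [Set.indicator_of_notMem (by simpa using hxR),
          Set.indicator_of_notMem (by simpa [hT] using hxR)]
    _ = ∫ r : Set.Ioi (0 : ℝ), (Set.Iic R).indicator (fun r => ∫ u, F r u ∂μ.toSphere) (r : ℝ)
          ∂(Measure.volumeIoiPow n) := by
      rw [integral_prod_symm _ hint]
      congr 1
      ext r
      by_cases hr : (r : ℝ) ≤ R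
      · rw [Set.indicator_of_mem (by simpa using hr)]
        congr 1
        ext u
        rw [Set.indicator_of_mem (by simpa [hT] using hr)]
      · rw [Set.indicator_of_notMem (by simpa using hr)]
        refine integral_eq_zero_of_ae (Filter.Eventually.of_forall fun u => ?_)
        simp only [Pi.zero_apply]
        rw [Set.indicator_of_notMem (by simpa [hT] using hr)]
    _ = ∫ r in Set.Ioi (0 : ℝ),
          r ^ n * (Set.Iic R).indicator (fun r => ∫ u, F r u ∂μ.toSphere) r := by
      simp only [Measure.volumeIoiPow, ENNReal.ofReal]
      rw [integral_withDensity_eq_integral_smul,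
        integral_subtype_comap measurableSet_Ioi fun a ↦ Real.toNNReal (a ^ n) •
          (Set.Iic R).indicator (fun r => ∫ u, F r u ∂μ.toSphere) a,
        setIntegral_congr_fun measurableSet_Ioi fun x hx ↦ ?_]
      · rw [NNReal.smul_def, Real.coe_toNNReal _ (pow_nonneg hx.out.le _), smul_eq_mul]
      · exact (measurable_subtype_coe.pow_const _).real_toNNReal
    _ = ∫ r in (0 : ℝ)..R, r ^ n * ∫ u, F r u ∂μ.toSphere := by
      rw [intervalIntegral.integral_of_le hR.le, ← Set.Ioi_inter_Iic,
        ← setIntegral_indicator measurableSet_Iic]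
      congr 1
      ext r
      by_cases hr : r ∈ Set.Iic R <;> simp [hr]

theorem deriv_cutoff (x e : E) (R : ℝ) (hx : x ≠ 0) (hxR : ‖x‖ ≠ R) :
    lineDeriv ℝ (fun y : E => max (R - ‖y‖) 0) x (-e) =
      (closedBall (0 : E) R).indicator (fun x => inner ℝ x e / ‖x‖) x := by
  have hn : HasDerivAt (fun t : ℝ => ‖x + t • (-e)‖) (- (inner ℝ x e / ‖x‖)) 0 := by
    have h0 : HasDerivAt (fun t : ℝ => x + t • (-e)) (-e) 0 := by
      simpa using ((hasDerivAt_id (0:ℝ)).smul_const (-e)).const_add x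
    have h1 := h0.norm_sq.sqrt (by simpa using hx)
    simp only [Real.sqrt_sq (norm_nonneg _)] at h1
    convert h1 using 1
    simp
    field_simp
  have hc : Filter.Tendsto (fun t : ℝ => ‖x + t • (-e)‖) (nhds 0) (nhds ‖x‖) := by
    simpa using hn.continuousAt.tendsto
  rw [lineDeriv]
  rcases lt_or_gt_of_ne hxR with h | h
  · rw [Set.indicator_of_mem (by simpa using h.le)]
    have h2 : HasDerivAt (fun t : ℝ => R - ‖x + t • (-e)‖) (inner ℝ x e / ‖x‖) 0 := by
      simpa using hn.const_sub R
    refine (h2.congr_of_eventuallyEq ?_).deriv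
    filter_upwards [hc.eventually (gt_mem_nhds h)] with t ht
    exact max_eq_left (by linarith)
  · rw [Set.indicator_of_notMem (by simpa using h)]
    refine ((hasDerivAt_const (0:ℝ) (0:ℝ)).congr_of_eventuallyEq ?_).deriv
    filter_upwards [hc.eventually (lt_mem_nhds h)] with t ht
    exact max_eq_right (by linarith)

theorem ibp_aux (μ : Measure E) [μ.IsAddHaarMeasure] (g : E → ℝ) (hg : ContDiff ℝ 1 g)
    (D : NNReal) (hD : LipschitzWith D g) (e : E) (R : ℝ) :
    ∫ x in closedBall (0 : E) R, fderiv ℝ g x e * (R - ‖x‖) ∂μ =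
      ∫ x in closedBall (0 : E) R, inner ℝ x e / ‖x‖ * g x ∂μ := by
  have hL : LipschitzWith 1 (fun y : E => max (R - ‖y‖) 0) := by
    have h1 : LipschitzWith 1 (fun y : E => R - ‖y‖) := by
      refine LipschitzWith.of_dist_le_mul fun a b => ?_
      rw [Real.dist_eq, dist_eq_norm]
      have := abs_norm_sub_norm_le a b
      rw [abs_sub_comm] at this
      simpa [abs_sub_comm] using this
    exact h1.max_const 0
  have hS : HasCompactSupport (fun y : E => max (R - ‖y‖) 0) := by
    refine HasCompactSupport.of_support_subset_isCompact (isCompact_closedBall (0:E) R) ?_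
    intro y hy
    simp only [Function.mem_support] at hy
    by_contra hc
    simp only [mem_closedBall, dist_zero_right, not_le] at hc
    exact hy (max_eq_right (by linarith))
  have key := LipschitzWith.integral_lineDeriv_mul_eq (μ := μ) hD hL hS e
  rw [← integral_indicator measurableSet_closedBall, ← integral_indicator measurableSet_closedBall]
  convert key using 1
  · congr 1
    ext x
    rw [((hg.differentiable (by norm_num)) x).lineDeriv_eq_fderiv]
    by_cases hx : ‖x‖ ≤ R
    · rw [Set.indicator_of_mem (by simpa using hx), max_eq_left (by linarith)]
    · rw [Set.indicator_of_notMem (by simpa using hx), max_eq_right (by linarith), mul_zero]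
  · refine integral_congr_ae ?_
    have h0 : ∀ᵐ x ∂μ, x ≠ 0 := by
      simp [ae_iff]
    have h1 : ∀ᵐ x ∂μ, ‖x‖ ≠ R := by
      have := Measure.addHaar_sphere μ (0:E) R
      rw [ae_iff]
      convert this using 2
      ext x; simp
    filter_upwards [h0, h1] with x hx hxR
    rw [deriv_cutoff x e R hx hxR]
    by_cases hx : ‖x‖ ≤ R
    · rw [Set.indicator_of_mem (by simpa using hx), Set.indicator_of_mem (by simpa using hx)]
    · rw [Set.indicator_of_notMem (by simpa using hx), Set.indicator_of_notMem (by simpa using hx),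
        zero_mul]

theorem divergence_aux (μ : Measure E) [μ.IsAddHaarMeasure] (g : E → ℝ) (hg : ContDiff ℝ 1 g)
    (D : NNReal) (hD : LipschitzWith D g) (e : E) :
    ∫ x in closedBall (0 : E) 1, fderiv ℝ g x e ∂μ =
      ∫ u : sphere (0 : E) 1, inner ℝ (u : E) e * g u ∂μ.toSphere := by
  have : CompactSpace (sphere (0 : E) 1) := isCompact_iff_compactSpace.1 (isCompact_sphere _ _)
  have hgc := hg.continuous
  have hg' : Continuous (fun x => fderiv ℝ g x e) :=
    (hg.continuous_fderiv (by norm_num)).clm_apply continuous_const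
  set n := Module.finrank ℝ E - 1 with hn
  have cont : ∀ F : ℝ → sphere (0 : E) 1 → ℝ,
      Continuous (fun p : ℝ × sphere (0 : E) 1 => F p.1 p.2) →
      Continuous (fun r : ℝ => r ^ n * ∫ u, F r u ∂μ.toSphere) := by
    intro F hF
    have := continuous_parametric_integral_of_continuous (μ := μ.toSphere) (f := F) hF
      (isCompact_univ (X := sphere (0 : E) 1))
    simp only [Measure.restrict_univ] at this
    fun_prop
  have hFK : Continuous (fun p : ℝ × sphere (0 : E) 1 => fderiv ℝ g (p.1 • (p.2 : E)) e) :=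
    hg'.comp (by fun_prop : Continuous (fun p : ℝ × sphere (0 : E) 1 => p.1 • (p.2 : E)))
  have hFL : Continuous (fun p : ℝ × sphere (0 : E) 1 =>
      inner ℝ (p.2 : E) e * g (p.1 • (p.2 : E))) := by fun_prop
  have hK := cont (fun r u => fderiv ℝ g (r • (u : E)) e) hFK
  have hLc := cont (fun r u => inner ℝ (u : E) e * g (r • (u : E))) hFL
  set K := fun r : ℝ => r ^ n * ∫ u : sphere (0 : E) 1, fderiv ℝ g (r • (u : E)) e ∂μ.toSphere
    with hKdef
  set L := fun r : ℝ => r ^ n * ∫ u : sphere (0 : E) 1,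
    inner ℝ (u : E) e * g (r • (u : E)) ∂μ.toSphere with hLdef
  have key : ∀ R : ℝ, 0 < R →
      R * (∫ r in (0:ℝ)..R, K r) - (∫ r in (0:ℝ)..R, r * K r) = ∫ r in (0:ℝ)..R, L r := by
    intro R hR
    have h1 := ibp_aux μ g hg D hD e R
    rw [polar_aux μ _ (fun r u => fderiv ℝ g (|r| • (u : E)) e * (R - |r|)) (by
        refine Continuous.mul (hg'.comp (by fun_prop : Continuous
          (fun p : ℝ × sphere (0 : E) 1 => |p.1| • (p.2 : E)))) (by fun_prop)) (by
        intro r u hr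
        simp [norm_smul, abs_of_pos hr]) R hR,
      polar_aux μ _ (fun r u => inner ℝ (u : E) e * g (r • (u : E))) hFL (by
        intro r u hr
        have h9 : ‖(u : E)‖ = 1 := by simp
        rw [norm_smul, h9, Real.norm_eq_abs, abs_of_pos hr, inner_smul_left]
        simp only [conj_trivial]
        congr 1
        field_simp) R hR] at h1
    have hrK : Continuous (fun r => r * K r) := continuous_id.mul hK
    rw [← h1, ← intervalIntegral.integral_const_mul, ← intervalIntegral.integral_sub
      ((hK.const_mul R).intervalIntegrable _ _) (hrK.intervalIntegrable _ _)]
    refine intervalIntegral.integral_congr fun r hr => ?_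
    rw [Set.uIcc_of_le hR.le] at hr
    simp only [abs_of_nonneg hr.1, integral_mul_const, hKdef]
    ring
  have fL := intervalIntegral.integral_hasDerivAt_right (hLc.intervalIntegrable 0 1)
    (hLc.stronglyMeasurableAtFilter _ _) hLc.continuousAt
  have fK := intervalIntegral.integral_hasDerivAt_right (hK.intervalIntegrable 0 1)
    (hK.stronglyMeasurableAtFilter _ _) hK.continuousAt
  have hrK : Continuous (fun r => r * K r) := continuous_id.mul hK
  have frK := intervalIntegral.integral_hasDerivAt_right (hrK.intervalIntegrable 0 1)
    (hrK.stronglyMeasurableAtFilter _ _) hrK.continuousAt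
  have f1 := ((hasDerivAt_id (1:ℝ)).mul fK).sub frK
  have f2 := fL.congr_of_eventuallyEq (f₁ := fun R : ℝ => R * (∫ r in (0:ℝ)..R, K r) -
    (∫ r in (0:ℝ)..R, r * K r)) (by
      filter_upwards [lt_mem_nhds (zero_lt_one (α := ℝ))] with R hR using key R hR)
  have h3 := f1.unique f2
  rw [polar_aux μ _ (fun r u => fderiv ℝ g (r • (u : E)) e) hFK (fun r u _ => rfl) 1 one_pos]
  have h4 : L 1 = ∫ u : sphere (0 : E) 1, inner ℝ (u : E) e * g u ∂μ.toSphere := by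
    simp [hLdef]
  rw [← h4, ← h3]
  simp [hKdef, hn]

end Helpers

/-- **Gradient-smoothing identity (Flaxman et al. / Yue et al., Lemma 1).**
For `f` continuously differentiable with bounded derivative, the smoothed function
`f̂` is differentiable and `𝔼_{u ~ Unif(S^{d-1})}[f (w + δ u) • u] = (δ / d) • ∇ f̂ (w)`. -/
theorem sphere_expectation_eq_smoothed_gradient
    (d : ℕ) (hd : 1 ≤ d)
    (f : EuclideanSpace ℝ (Fin d) → ℝ) (hf : ContDiff ℝ 1 f)
    (C : ℝ) (hbdd : ∀ x, ‖fderiv ℝ f x‖ ≤ C)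
    (δ : ℝ) (hδ : 0 < δ) (w : EuclideanSpace ℝ (Fin d)) :
    DifferentiableAt ℝ (smoothed d δ f) w ∧
      (∫ u : sphere (0 : EuclideanSpace ℝ (Fin d)) 1,
          f (w + δ • (u : EuclideanSpace ℝ (Fin d))) • (u : EuclideanSpace ℝ (Fin d))
          ∂(sphereUniform d)) =
        (δ / d) • gradient (smoothed d δ f) w := by
  have : Nonempty (Fin d) := ⟨⟨0, hd⟩⟩
  have : Nontrivial (EuclideanSpace ℝ (Fin d)) := inferInstance
  have : CompactSpace (sphere (0 : EuclideanSpace ℝ (Fin d)) 1) :=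
    isCompact_iff_compactSpace.1 (isCompact_sphere _ _)
  have hfc := hf.continuous
  have hf' := hf.continuous_fderiv (by norm_num)
  have hfd : Differentiable ℝ f := hf.differentiable (by norm_num)
  have hd0 : (d : ℝ) ≠ 0 := by positivity
  set V := volume (closedBall (0 : EuclideanSpace ℝ (Fin d)) 1) with hV
  have hVtop : V ≠ ⊤ := (isCompact_closedBall _ _).measure_lt_top.ne
  have hV0 : V ≠ 0 := (measure_closedBall_pos _ _ one_pos).ne'
  -- integrability
  have int_cont : ∀ {G : Type} [NormedAddCommGroup G] (h : EuclideanSpace ℝ (Fin d) → G),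
      Continuous h → IntegrableOn h (closedBall (0 : EuclideanSpace ℝ (Fin d)) 1) volume := by
    intro G _ h hh
    exact hh.continuousOn.integrableOn_compact (isCompact_closedBall _ _)
  have hder : HasFDerivAt (fun x => ∫ v in closedBall (0 : EuclideanSpace ℝ (Fin d)) 1,
      f (x + δ • v)) (∫ v in closedBall (0 : EuclideanSpace ℝ (Fin d)) 1,
      fderiv ℝ f (w + δ • v)) w := by
    refine hasFDerivAt_integral_of_dominated_of_fderiv_le (s := Set.univ) (bound := fun _ => C)
      (F := fun x v => f (x + δ • v)) (F' := fun x v => fderiv ℝ f (x + δ • v))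
      Filter.univ_mem ?_ ?_ ?_ ?_ ?_ ?_
    · exact Filter.Eventually.of_forall fun x => Continuous.aestronglyMeasurable (by fun_prop)
    · exact int_cont _ (by fun_prop)
    · exact Continuous.aestronglyMeasurable (by fun_prop)
    · exact Filter.Eventually.of_forall fun v x _ => hbdd _
    · exact int_cont _ continuous_const
    · refine Filter.Eventually.of_forall fun v x _ => ?_
      have h2 := (hfd (x + δ • v)).hasFDerivAt.comp x ((hasFDerivAt_id x).add_const (δ • v))
      simpa [Function.comp_def] using h2
  have hsm : smoothed d δ f = fun x => V.toReal⁻¹ *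
      ∫ v in closedBall (0 : EuclideanSpace ℝ (Fin d)) 1, f (x + δ • v) := by
    ext x
    simp [smoothed, ballUniform, integral_smul_measure, hV]
  have hder2 : HasFDerivAt (smoothed d δ f) (V.toReal⁻¹ •
      ∫ v in closedBall (0 : EuclideanSpace ℝ (Fin d)) 1, fderiv ℝ f (w + δ • v)) w := by
    rw [hsm]
    exact hder.const_mul _
  refine ⟨hder2.differentiableAt, ?_⟩
  have hgd : ∀ x e : EuclideanSpace ℝ (Fin d),
      fderiv ℝ (fun v => f (w + δ • v)) x e = δ * fderiv ℝ f (w + δ • x) e := by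
    intro x e
    have h1 : HasFDerivAt (fun v : EuclideanSpace ℝ (Fin d) => w + δ • v)
        (δ • ContinuousLinearMap.id ℝ (EuclideanSpace ℝ (Fin d))) x :=
      ((hasFDerivAt_id x).const_smul δ).const_add w
    have h2 := (hfd (w + δ • x)).hasFDerivAt.comp x h1
    have h3 : fderiv ℝ (fun v => f (w + δ • v)) x = _ := h2.fderiv
    rw [h3]
    simp
  have hLf : LipschitzWith C.toNNReal f := by
    refine lipschitzWith_of_nnnorm_fderiv_le hfd fun x => ?_
    rw [← NNReal.coe_le_coe, coe_nnnorm]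
    exact (hbdd x).trans (Real.le_coe_toNNReal C)
  have hLg : LipschitzWith (C.toNNReal * δ.toNNReal) (fun v => f (w + δ • v)) := by
    refine hLf.comp (LipschitzWith.of_dist_le_mul fun a b => ?_)
    simp [dist_smul₀, abs_of_pos hδ, hδ.le]
  have hgC : ContDiff ℝ 1 (fun v : EuclideanSpace ℝ (Fin d) => f (w + δ • v)) := by fun_prop
  have hσ : ((volume (α := EuclideanSpace ℝ (Fin d))).toSphere Set.univ) = d * V := by
    rw [Measure.toSphere_apply_univ, hV, Measure.addHaar_closedBall_eq_addHaar_ball]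
    simp
  have hintS : Integrable (fun u : sphere (0 : EuclideanSpace ℝ (Fin d)) 1 =>
      f (w + δ • (u : EuclideanSpace ℝ (Fin d))) • (u : EuclideanSpace ℝ (Fin d)))
      (volume (α := EuclideanSpace ℝ (Fin d))).toSphere := by
    refine Continuous.integrable_of_hasCompactSupport (by fun_prop) ?_
    exact HasCompactSupport.of_compactSpace _
  refine ext_inner_left ℝ fun e => ?_
  have key := divergence_aux volume _ hgC _ hLg e
  rw [sphereUniform, integral_smul_measure, hσ, inner_smul_right, inner_smul_right,
    ← integral_inner hintS, real_inner_comm _ e, gradient, InnerProductSpace.toDual_symm_apply,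
    hder2.fderiv]
  simp only [hgd, integral_const_mul] at key
  have h5 : ∫ u : sphere (0 : EuclideanSpace ℝ (Fin d)) 1,
      inner ℝ e (f (w + δ • (u : EuclideanSpace ℝ (Fin d))) • (u : EuclideanSpace ℝ (Fin d)))
        ∂(volume (α := EuclideanSpace ℝ (Fin d))).toSphere =
      δ * ∫ x in closedBall (0 : EuclideanSpace ℝ (Fin d)) 1, fderiv ℝ f (w + δ • x) e := by
    rw [key]
    congr 1
    ext u
    rw [inner_smul_right, real_inner_comm, mul_comm]
  rw [h5, smul_apply,
    ContinuousLinearMap.integral_apply (φ := fun v => fderiv ℝ f (w + δ • v))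
      (int_cont (fun v => fderiv ℝ f (w + δ • v)) (by fun_prop)).integrable e]
  simp only [ENNReal.toReal_inv, ENNReal.toReal_mul, ENNReal.toReal_natCast, smul_eq_mul]
  have : V.toReal ≠ 0 := ENNReal.toReal_ne_zero.2 ⟨hV0, hVtop⟩
  field_simp
end

section
/- Let d ≥ 1, let A : ℝ^d → ℝ^d be an orthogonal projection (a linear map with A ∘ A = A and A self-adjoint), let F : ℝ^d → ℝ be continuously differentiable with bounded derivative, define f = F ∘ A, let δ > 0 and w ∈ ℝ^d, and define the smoothed function f̂(w) = E_{v ~ Unif(B^d)}[f(w + δ v)]. Then E_{u ~ Unif(S^{d-1})}[f(w + δ u) · A u] = (δ/d) ∇f̂(w); that is, the projected update direction f(w + δu) · A u is, up to the factor δ/d, an unbiased estimate of the gradient of the smoothed loss f̂ at w. -/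
open MeasureTheory Metric
open scoped RealInnerProductSpace

section helpers
set_option linter.unusedSectionVars false
variable {E : Type*} [NormedAddCommGroup E] [InnerProductSpace ℝ E] [FiniteDimensional ℝ E]
  [MeasurableSpace E] [BorelSpace E] [Nontrivial E] (μ : Measure E) [μ.IsAddHaarMeasure]

lemma hs_polar (h : E → ℝ) (hh : Integrable h μ) :
    ∫ x, h x ∂μ = ∫ r in Set.Ioi (0:ℝ), r ^ (Module.finrank ℝ E - 1) *
      ∫ u : sphere (0:E) 1, h (r • (u:E)) ∂μ.toSphere := by
  have mp := μ.measurePreserving_homeomorphUnitSphereProd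
  have emb : MeasurableEmbedding (homeomorphUnitSphereProd E) := Homeomorph.measurableEmbedding _
  set k : sphere (0:E) 1 × Set.Ioi (0:ℝ) → ℝ := fun p => h ((p.2 : ℝ) • (p.1 : E)) with hk
  have hcomp : ∀ x : ({0}ᶜ : Set E), k (homeomorphUnitSphereProd E x) = h x := by
    intro x
    have h0 : ‖(x:E)‖ ≠ 0 := norm_ne_zero_iff.2 x.2
    simp [hk, homeomorphUnitSphereProd, smul_smul, h0]
  have kint : Integrable k (μ.toSphere.prod (.volumeIoiPow (Module.finrank ℝ E - 1))) := by
    rw [← mp.integrable_comp_emb emb]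
    have : k ∘ (homeomorphUnitSphereProd E) = h ∘ (Subtype.val) := funext hcomp
    rw [this, ← integrableOn_iff_comap_subtypeVal (measurableSet_singleton _).compl]
    exact hh.integrableOn
  calc
    ∫ x, h x ∂μ = ∫ x : ({(0)}ᶜ : Set E), h x.1 ∂(μ.comap (↑)) := by
      rw [integral_subtype_comap (measurableSet_singleton _).compl fun x ↦ h x,
        restrict_compl_singleton]
    _ = ∫ x, k x ∂μ.toSphere.prod (.volumeIoiPow (Module.finrank ℝ E - 1)) := by
      rw [← mp.integral_comp emb]
      simp_rw [hcomp]
    _ = ∫ x : Set.Ioi (0 : ℝ), (∫ u : sphere (0:E) 1, h ((x:ℝ) • (u:E)) ∂μ.toSphere)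
          ∂.volumeIoiPow (Module.finrank ℝ E - 1) := by
      rw [integral_prod_symm _ kint]
    _ = _ := by
      simp only [Measure.volumeIoiPow, ENNReal.ofReal]
      rw [integral_withDensity_eq_integral_smul,
        integral_subtype_comap measurableSet_Ioi fun a ↦ Real.toNNReal (a ^ (Module.finrank ℝ E - 1)) • (∫ u : sphere (0:E) 1, h (a • (u:E)) ∂μ.toSphere),
        setIntegral_congr_fun measurableSet_Ioi fun x hx ↦ ?_]
      · simp only [NNReal.smul_def, Real.coe_toNNReal _ (pow_nonneg (Set.mem_Ioi.1 hx).le _), smul_eq_mul]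
      · exact (measurable_subtype_coe.pow_const _).real_toNNReal

lemma hs_polar_ball (h : E → ℝ) (s : ℝ) (hs : 0 ≤ s) (hh : IntegrableOn h (closedBall 0 s) μ) :
    ∫ x in closedBall (0:E) s, h x ∂μ = ∫ r in (0:ℝ)..s, r ^ (Module.finrank ℝ E - 1) *
      ∫ u : sphere (0:E) 1, h (r • (u:E)) ∂μ.toSphere := by
  rw [← integral_indicator measurableSet_closedBall, hs_polar μ _
    ((integrable_indicator_iff measurableSet_closedBall).2 hh),
    intervalIntegral.integral_of_le hs, ← Set.Ioi_inter_Iic,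
    ← setIntegral_indicator measurableSet_Iic]
  refine setIntegral_congr_fun measurableSet_Ioi fun r hr => ?_
  have hr : 0 < r := hr
  have hm : ∀ u : sphere (0:E) 1, (r • (u:E) ∈ closedBall (0:E) s ↔ r ≤ s) := by
    intro u; simp [norm_smul, abs_of_pos hr]
  by_cases hrs : r ≤ s <;> simp [Set.indicator, hm, hrs]

lemma hs_cont (k : E → ℝ) (q : E → ℝ) (hk : Continuous k) (hq : Continuous q) :
    Continuous fun r : ℝ => ∫ u : sphere (0:E) 1, q u * k (r • (u:E)) ∂μ.toSphere := by
  have : CompactSpace (sphere (0:E) 1) := isCompact_iff_compactSpace.1 (isCompact_sphere _ _)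
  have := continuous_parametric_integral_of_continuous (μ := μ.toSphere) (s := Set.univ)
    (f := fun (r:ℝ) (u : sphere (0:E) 1) => q u * k (r • (u:E))) (by fun_prop) isCompact_univ
  simpa using this

lemma hs_cut_deriv (s : ℝ) (y x : E) (hx0 : x ≠ 0) (hxs : ‖x‖ ≠ s) :
    lineDeriv ℝ (fun x : E => max (s - ‖x‖) 0) x (-y) =
      (closedBall (0:E) s).indicator (fun x => ⟪‖x‖⁻¹ • x, y⟫) x := by
  rcases lt_or_gt_of_ne hxs with h | h
  · have hev : (fun x : E => max (s - ‖x‖) 0) =ᶠ[nhds x] fun x => s - ‖x‖ := by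
      have : ∀ᶠ z in nhds x, ‖z‖ < s := continuous_norm.continuousAt.eventually_lt_const h
      filter_upwards [this] with z hz
      exact max_eq_left (by linarith)
    rw [hev.lineDeriv_eq]
    have hd : HasFDerivAt (fun z : E => ‖z‖) (‖x‖⁻¹ • innerSL ℝ x) x := by
      have h1 := (hasStrictFDerivAt_norm_sq x).hasFDerivAt
      have h2 := h1.sqrt (by simpa using hx0)
      simp only [Real.sqrt_sq (norm_nonneg _)] at h2
      convert h2 using 1
      ext z
      simp
      field_simp
    have hd2 : HasFDerivAt (fun z : E => s - ‖z‖) (-(‖x‖⁻¹ • innerSL ℝ x)) x := hd.const_sub s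
    rw [hd2.differentiableAt.lineDeriv_eq_fderiv, hd2.fderiv, Set.indicator_of_mem (by simpa using h.le)]
    simp [inner_smul_left]
  · have hev : (fun x : E => max (s - ‖x‖) 0) =ᶠ[nhds x] fun x => 0 := by
      have : ∀ᶠ z in nhds x, s < ‖z‖ := continuous_norm.continuousAt.eventually_const_lt h
      filter_upwards [this] with z hz
      exact max_eq_right (by linarith)
    rw [hev.lineDeriv_eq, Set.indicator_of_notMem (by simpa using h)]
    simp [lineDeriv]

lemma hs_ibp (g : E → ℝ) (hg : ContDiff ℝ 1 g) {C : NNReal} (hL : LipschitzWith C g) (y : E)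
    (s : ℝ) :
    ∫ x in closedBall (0:E) s, (s - ‖x‖) * fderiv ℝ g x y ∂μ
      = ∫ x in closedBall (0:E) s, ⟪‖x‖⁻¹ • x, y⟫ * g x ∂μ := by
  have hlip : LipschitzWith 1 (fun x : E => max (s - ‖x‖) 0) := by
    refine LipschitzWith.max_const ?_ 0
    refine LipschitzWith.of_dist_le_mul fun a b => ?_
    simp only [NNReal.coe_one, one_mul, dist_eq_norm]
    rw [sub_sub_sub_cancel_left, Real.norm_eq_abs, abs_sub_comm]
    exact abs_norm_sub_norm_le a b
  have hcs : HasCompactSupport (fun x : E => max (s - ‖x‖) 0) := by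
    refine HasCompactSupport.intro (isCompact_closedBall (0:E) s) fun x hx => ?_
    simp at hx
    exact max_eq_right (by linarith)
  have key := hL.integral_lineDeriv_mul_eq (μ := μ) hlip hcs y
  rw [← integral_indicator measurableSet_closedBall, ← integral_indicator measurableSet_closedBall]
  convert key using 1
  · refine integral_congr_ae (.of_forall fun x => ?_)
    simp only [Set.indicator, mem_closedBall, dist_zero_right]
    rw [(hg.differentiable (by simp) x).lineDeriv_eq_fderiv]
    split_ifs with h
    · rw [max_eq_left (by linarith)]; ring
    · rw [max_eq_right (by linarith)]; ring
  · refine integral_congr_ae ?_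
    have h0 : ∀ᵐ x ∂μ, x ≠ 0 := by simp [ae_iff]
    have h1 : ∀ᵐ x ∂μ, x ∉ sphere (0:E) s := measure_eq_zero_iff_ae_notMem.1 (Measure.addHaar_sphere μ 0 s)
    filter_upwards [h0, h1] with x h0 h1
    rw [hs_cut_deriv s y x h0 (by simpa using h1)]
    simp only [Set.indicator]
    split_ifs <;> simp

lemma hs_div (g : E → ℝ) (hg : ContDiff ℝ 1 g) {C : NNReal} (hL : LipschitzWith C g) (y : E) :
    ∫ x in closedBall (0:E) 1, fderiv ℝ g x y ∂μ
      = ∫ u : sphere (0:E) 1, ⟪(u:E), y⟫ * g u ∂μ.toSphere := by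
  have hgc : Continuous fun x => fderiv ℝ g x y := (hg.continuous_fderiv (by simp)).clm_apply continuous_const
  set n := Module.finrank ℝ E - 1
  set p : ℝ → ℝ := fun r => r ^ n * ∫ u : sphere (0:E) 1, fderiv ℝ g (r • (u:E)) y ∂μ.toSphere with hp
  set q : ℝ → ℝ := fun r => r ^ n * ∫ u : sphere (0:E) 1, ⟪(u:E), y⟫ * g (r • (u:E)) ∂μ.toSphere with hq
  have hpc : Continuous p := by
    have := hs_cont μ (fun x => fderiv ℝ g x y) (fun _ => 1) hgc continuous_const
    simp only [one_mul] at this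
    exact (continuous_pow n).mul this
  have hqc : Continuous q := by
    have := hs_cont μ g (fun x => ⟪x, y⟫) hg.continuous (by fun_prop)
    exact (continuous_pow n).mul this
  have hint : ∀ {f : E → ℝ} (_ : Continuous f) (s : ℝ), IntegrableOn f (closedBall 0 s) μ :=
    fun hf s => hf.continuousOn.integrableOn_compact (isCompact_closedBall _ _)
  have main : ∀ s : ℝ, 0 < s → s * (∫ r in (0:ℝ)..s, p r) - (∫ r in (0:ℝ)..s, r * p r) = ∫ r in (0:ℝ)..s, q r := by
    intro s hs
    have h1 := hs_ibp μ g hg hL y s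
    rw [hs_polar_ball μ _ s hs.le (hint (by fun_prop) s), hs_polar_ball μ _ s hs.le ?_] at h1
    · rw [← intervalIntegral.integral_const_mul, ← intervalIntegral.integral_sub
        ((by fun_prop : Continuous _).intervalIntegrable _ _) ((by fun_prop : Continuous _).intervalIntegrable _ _)]
      convert h1 using 1
      · refine intervalIntegral.integral_congr_ae (.of_forall fun r hr => ?_)
        rw [Set.uIoc_of_le hs.le] at hr
        simp only [norm_smul, Real.norm_eq_abs, abs_of_pos hr.1, norm_eq_of_mem_sphere, mul_one]
        rw [integral_const_mul]
        simp only [hp]; ring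
      · refine intervalIntegral.integral_congr_ae (.of_forall fun r hr => ?_)
        rw [Set.uIoc_of_le hs.le] at hr
        simp only [norm_smul, Real.norm_eq_abs, abs_of_pos hr.1, norm_eq_of_mem_sphere, mul_one, smul_smul,
          inv_mul_cancel₀ hr.1.ne', one_smul]
        rfl
    · refine (hint (hg.continuous.norm.const_mul ‖y‖) s).mono' ?_ (.of_forall fun x => ?_)
      · have : Measurable fun x : E => ⟪‖x‖⁻¹ • x, y⟫ * g x := by
          have := hg.continuous.measurable
          fun_prop
        exact this.aestronglyMeasurable
      · rw [norm_mul]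
        gcongr
        refine (norm_inner_le_norm _ _).trans ?_
        have : ‖‖x‖⁻¹ • x‖ ≤ 1 := by
          rw [norm_smul, norm_inv, norm_norm]; exact inv_mul_le_one
        nlinarith [norm_nonneg y]
  have d1 : HasDerivAt (fun s => s * (∫ r in (0:ℝ)..s, p r) - (∫ r in (0:ℝ)..s, r * p r)) (∫ r in (0:ℝ)..1, p r) 1 := by
    have a := hpc.integral_hasStrictDerivAt 0 1 |>.hasDerivAt
    have b := (continuous_id.mul hpc).integral_hasStrictDerivAt 0 1 |>.hasDerivAt
    have e := ((hasDerivAt_id (1:ℝ)).mul a).sub b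
    have e2 : (1 * ∫ (x : ℝ) in (0:ℝ)..1, p x) + id 1 * p 1 - ((id : ℝ → ℝ) * p) 1 = ∫ r in (0:ℝ)..1, p r := by
      simp
    rw [e2] at e
    exact e
  have d2 := hqc.integral_hasStrictDerivAt 0 1 |>.hasDerivAt
  have hev : (fun s => s * (∫ r in (0:ℝ)..s, p r) - (∫ r in (0:ℝ)..s, r * p r)) =ᶠ[nhds 1] fun s => ∫ r in (0:ℝ)..s, q r := by
    filter_upwards [lt_mem_nhds (zero_lt_one : (0:ℝ) < 1)] with s hs using main s hs
  have h2 := d1.unique (d2.congr_of_eventuallyEq hev)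
  rw [hs_polar_ball μ _ 1 zero_le_one (hint hgc 1)]
  change ∫ r in (0:ℝ)..1, p r = _
  rw [h2]
  simp [hq]

end helpers

/-- **Unbiasedness of the projected update direction.**
If `A` is an orthogonal projection of `ℝ^d`, `F` is continuously differentiable with
bounded derivative, and `f = F ∘ A`, then
`𝔼_{u ~ Unif(S^{d-1})}[f (w + δ u) • A u] = (δ / d) • ∇ f̂ (w)`,
where `f̂` is the ball-smoothed version of `f`. -/
theorem projected_sphere_expectation_eq_smoothed_gradient
    (d : ℕ) (hd : 1 ≤ d)
    (A : EuclideanSpace ℝ (Fin d) →ₗ[ℝ] EuclideanSpace ℝ (Fin d))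
    (hidem : A ∘ₗ A = A)
    (hsa : ∀ x y : EuclideanSpace ℝ (Fin d), ⟪A x, y⟫ = ⟪x, A y⟫)
    (F : EuclideanSpace ℝ (Fin d) → ℝ) (hF : ContDiff ℝ 1 F)
    (C : ℝ) (hbdd : ∀ x, ‖fderiv ℝ F x‖ ≤ C)
    (δ : ℝ) (hδ : 0 < δ) (w : EuclideanSpace ℝ (Fin d)) :
    (∫ u : sphere (0 : EuclideanSpace ℝ (Fin d)) 1,
        (F ∘ A) (w + δ • (u : EuclideanSpace ℝ (Fin d))) •
          A (u : EuclideanSpace ℝ (Fin d))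
        ∂(sphereUniform d)) =
      (δ / d) • gradient (smoothed d δ (F ∘ A)) w := by
  have : Nonempty (Fin d) := ⟨⟨0, hd⟩⟩
  have hd0 : (d:ℝ) ≠ 0 := by positivity
  set B : (EuclideanSpace ℝ (Fin d)) →L[ℝ] (EuclideanSpace ℝ (Fin d)) := LinearMap.toContinuousLinearMap A with hB
  have hBA : ∀ x, A x = B x := fun x => rfl
  have hBB : ∀ x, B (B x) = B x := fun x => LinearMap.congr_fun hidem x
  set f : (EuclideanSpace ℝ (Fin d)) → ℝ := F ∘ A with hf
  have hfB : f = F ∘ B := rfl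
  have hfc : ContDiff ℝ 1 f := by rw [hfB]; exact hF.comp B.contDiff
  have hfd : ∀ x, HasFDerivAt f ((fderiv ℝ F (B x)).comp B) x := fun x =>
    ((hF.differentiable (by simp) (B x)).hasFDerivAt).comp x B.hasFDerivAt
  have hfb : ∀ x, ‖fderiv ℝ f x‖ ≤ C * ‖B‖ := by
    intro x
    rw [(hfd x).fderiv]
    refine (ContinuousLinearMap.opNorm_comp_le _ _).trans ?_
    gcongr
    exact hbdd _
  have hfA : ∀ x y, fderiv ℝ f x (B y) = fderiv ℝ f x y := by
    intro x y
    rw [(hfd x).fderiv]; simp [hBB]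
  have hvol0 : volume (closedBall (0:(EuclideanSpace ℝ (Fin d))) 1) ≠ 0 := (measure_closedBall_pos _ _ one_pos).ne'
  have hvolT : volume (closedBall (0:(EuclideanSpace ℝ (Fin d))) 1) ≠ ⊤ := measure_closedBall_lt_top.ne
  have hfin : IsFiniteMeasure (ballUniform d) := by
    unfold ballUniform
    have := Measure.restrict_apply_univ (μ := (volume : Measure (EuclideanSpace ℝ (Fin d)))) (closedBall (0:(EuclideanSpace ℝ (Fin d))) 1)
    constructor
    rw [Measure.smul_apply, this, smul_eq_mul, ENNReal.inv_mul_cancel hvol0 hvolT]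
    exact ENNReal.one_lt_top
  have hcontint : ∀ {f : (EuclideanSpace ℝ (Fin d)) → ℝ} (_ : Continuous f), Integrable f (ballUniform d) := by
    intro f hf
    unfold ballUniform
    refine Integrable.smul_measure ?_ (ENNReal.inv_ne_top.2 hvol0)
    exact hf.continuousOn.integrableOn_compact (isCompact_closedBall _ _)
  have hfdc : Continuous (fun v : (EuclideanSpace ℝ (Fin d)) => fderiv ℝ f (w + δ • v)) :=
    (hfc.continuous_fderiv (by simp)).comp (by fun_prop)
  have hgrad : HasFDerivAt (smoothed d δ f) (∫ v, fderiv ℝ f (w + δ • v) ∂(ballUniform d)) w := by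
    refine hasFDerivAt_integral_of_dominated_of_fderiv_le (s := Set.univ)
      (F := fun (w v : (EuclideanSpace ℝ (Fin d))) => f (w + δ • v)) (F' := fun (w v : (EuclideanSpace ℝ (Fin d))) => fderiv ℝ f (w + δ • v))
      (bound := fun _ => C * ‖B‖) Filter.univ_mem
      (.of_forall fun x => ?_) (hcontint ?_) ?_ (.of_forall fun v x _ => hfb _)
      (integrable_const _) (.of_forall fun v x _ => ?_)
    · have := hfc.continuous
      exact (by fun_prop : Continuous _).aestronglyMeasurable
    · have := hfc.continuous
      fun_prop
    · exact hfdc.aestronglyMeasurable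
    · exact (hasFDerivAt_comp_add_right (δ • v)).2 (hfc.differentiable (by simp) _).hasFDerivAt
  have hfdi : Integrable (fun v : (EuclideanSpace ℝ (Fin d)) => fderiv ℝ f (w + δ • v)) (ballUniform d) :=
    (integrable_const (C * ‖B‖)).mono' hfdc.aestronglyMeasurable (.of_forall fun v => hfb _)
  refine ext_inner_right ℝ fun y => ?_
  have hcs : CompactSpace (sphere (0:(EuclideanSpace ℝ (Fin d))) 1) := isCompact_iff_compactSpace.1 (isCompact_sphere _ _)
  have hsfin : ((volume : Measure (EuclideanSpace ℝ (Fin d))).toSphere Set.univ)⁻¹ ≠ ⊤ := by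
    rw [ENNReal.inv_ne_top, Measure.toSphere_apply_univ]
    refine mul_ne_zero (by simpa using (by omega : d ≠ 0)) (measure_ball_pos _ _ one_pos).ne'
  have hsint : Integrable (fun u : sphere (0:(EuclideanSpace ℝ (Fin d))) 1 => f (w + δ • (u:(EuclideanSpace ℝ (Fin d)))) • A (u:(EuclideanSpace ℝ (Fin d)))) (sphereUniform d) := by
    unfold sphereUniform
    refine Integrable.smul_measure ?_ hsfin
    have h1 := hfc.continuous
    simp only [hBA]
    exact (by fun_prop : Continuous _).integrable_of_hasCompactSupport
      (HasCompactSupport.of_compactSpace _)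
  -- divergence theorem
  set g : (EuclideanSpace ℝ (Fin d)) → ℝ := fun v => f (w + δ • v) with hg
  have hgc : ContDiff ℝ 1 g := hfc.comp (by fun_prop)
  have hgd : ∀ v, fderiv ℝ g v = δ • fderiv ℝ f (w + δ • v) := by
    intro v
    have h1 : HasFDerivAt (fun v : (EuclideanSpace ℝ (Fin d)) => w + δ • v) (δ • ContinuousLinearMap.id ℝ (EuclideanSpace ℝ (Fin d))) v :=
      ((hasFDerivAt_id v).const_smul δ).const_add w
    have h2 := ((hfc.differentiable (by simp) (w + δ • v)).hasFDerivAt).comp v h1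
    rw [show g = f ∘ (fun v : (EuclideanSpace ℝ (Fin d)) => w + δ • v) from rfl, h2.fderiv]
    ext z; simp
  have hgL : LipschitzWith (Real.toNNReal (δ * (C * ‖B‖))) g := by
    refine lipschitzWith_of_nnnorm_fderiv_le (𝕜 := ℝ) (hgc.differentiable (by simp)) fun x => ?_
    rw [← NNReal.coe_le_coe, coe_nnnorm]
    refine le_trans ?_ (Real.le_coe_toNNReal _)
    rw [hgd, norm_smul, Real.norm_of_nonneg hδ.le]
    gcongr
    exact hfb _
  have key := hs_div (volume : Measure (EuclideanSpace ℝ (Fin d))) g hgc hgL (B y)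
  simp only [hgd, _root_.smul_apply, hfA, smul_eq_mul] at key
  rw [integral_const_mul] at key
  have hL : ⟪∫ u : sphere (0:(EuclideanSpace ℝ (Fin d))) 1, f (w + δ • (u:(EuclideanSpace ℝ (Fin d)))) • A (u:(EuclideanSpace ℝ (Fin d))) ∂(sphereUniform d), y⟫ =
      ((volume : Measure (EuclideanSpace ℝ (Fin d))).toSphere Set.univ)⁻¹.toReal *
        ∫ u : sphere (0:(EuclideanSpace ℝ (Fin d))) 1, ⟪(u:(EuclideanSpace ℝ (Fin d))), B y⟫ * g u ∂(volume : Measure (EuclideanSpace ℝ (Fin d))).toSphere := by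
    rw [real_inner_comm, ← integral_inner hsint, sphereUniform, integral_smul_measure, smul_eq_mul]
    congr 1
    refine integral_congr_ae (.of_forall fun u => ?_)
    simp only [inner_smul_right]
    rw [real_inner_comm, hsa, mul_comm]
    rfl
  have hR : ⟪(δ / d) • gradient (smoothed d δ f) w, y⟫ =
      (δ / d) * ((volume (closedBall (0:(EuclideanSpace ℝ (Fin d))) 1))⁻¹.toReal *
        ∫ v in closedBall (0:(EuclideanSpace ℝ (Fin d))) 1, fderiv ℝ f (w + δ • v) y) := by
    rw [inner_smul_left, gradient, InnerProductSpace.toDual_symm_apply, hgrad.fderiv,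
      ContinuousLinearMap.integral_apply hfdi, ballUniform, integral_smul_measure, smul_eq_mul]
    simp
  rw [hL, hR, ← key, Measure.toSphere_apply_univ, ← Measure.addHaar_closedBall_eq_addHaar_ball]
  simp only [ENNReal.toReal_inv, ENNReal.toReal_mul, ENNReal.toReal_natCast, finrank_euclideanSpace, Fintype.card_fin]
  rw [mul_inv]
  ring
end
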